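/- For any fixed real number ρ with 0 < ρ < 1, the set of positive integers m for which either some iterate T^(i)(m) = 1 or some iterate T^(i)(m) < ρ·m has natural density one. -/

import Mathlib

open Filter

/-- The 3x+1 function `T : ℤ → ℤ`. -/
def collatzT (x : ℤ) : ℤ := if x % 2 = 1 then (3 * x + 1) / 2 else x / 2

open scoped Classical

lemma collatzT_two_mul (j : ℤ) : collatzT (2 * j) = j := by
  unfold collatzT; split_ifs <;> omega

lemma collatzT_two_mul_add_one (j : ℤ) : collatzT (2 * j + 1) = 3 * j + 2 := by
  unfold collatzT; split_ifs <;> omega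

/-- The product of a factor `c` for each odd term among the first `k` iterates of `n`. -/
noncomputable def oddWeight (c : ℝ) : ℕ → ℤ → ℝ
  | 0, _ => 1
  | k + 1, n => (if n % 2 = 1 then c else 1) * oddWeight c k (collatzT n)

lemma oddWeight_two_mul (c : ℝ) (k : ℕ) (j : ℤ) :
    oddWeight c (k + 1) (2 * j) = oddWeight c k j := by
  rw [oddWeight, collatzT_two_mul, if_neg (by omega), one_mul]

lemma oddWeight_two_mul_add_one (c : ℝ) (k : ℕ) (j : ℤ) :
    oddWeight c (k + 1) (2 * j + 1) = c * oddWeight c k (3 * j + 2) := by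
  rw [oddWeight, collatzT_two_mul_add_one, if_pos (by omega)]

lemma oddWeight_nonneg {c : ℝ} (hc : 0 ≤ c) (k : ℕ) (n : ℤ) : 0 ≤ oddWeight c k n := by
  induction k generalizing n with
  | zero => simp [oddWeight]
  | succ k ih =>
    rw [oddWeight]
    exact mul_nonneg (by split_ifs <;> positivity) (ih _)

lemma oddWeight_le_pow {c : ℝ} (hc : 1 ≤ c) (k : ℕ) (n : ℤ) : oddWeight c k n ≤ c ^ k := by
  induction k generalizing n with
  | zero => simp [oddWeight]
  | succ k ih =>
    rw [oddWeight, pow_succ']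
    refine mul_le_mul ?_ (ih _) (oddWeight_nonneg (by linarith) _ _) (by linarith)
    split_ifs <;> linarith

lemma oddWeight_add_two_pow_mul (c : ℝ) (k : ℕ) (n z : ℤ) :
    oddWeight c k (n + 2 ^ k * z) = oddWeight c k n := by
  induction k generalizing n z with
  | zero => simp [oddWeight]
  | succ k ih =>
    obtain ⟨j, rfl | rfl⟩ := Int.even_or_odd' n
    · rw [show 2 * j + 2 ^ (k + 1) * z = 2 * (j + 2 ^ k * z) by ring,
        oddWeight_two_mul, oddWeight_two_mul, ih]
    · rw [show 2 * j + 1 + 2 ^ (k + 1) * z = 2 * (j + 2 ^ k * z) + 1 by ring,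
        oddWeight_two_mul_add_one, oddWeight_two_mul_add_one,
        show 3 * (j + 2 ^ k * z) + 2 = 3 * j + 2 + 2 ^ k * (3 * z) by ring, ih]

lemma oddWeight_emod (c : ℝ) (k : ℕ) (n : ℤ) :
    oddWeight c k (n % 2 ^ k) = oddWeight c k n := by
  conv_rhs => rw [← Int.emod_add_mul_ediv n (2 ^ k), oddWeight_add_two_pow_mul]

lemma sum_range_two_mul (f : ℕ → ℝ) (n : ℕ) :
    ∑ i ∈ Finset.range (2 * n), f i =
      ∑ j ∈ Finset.range n, f (2 * j) + ∑ j ∈ Finset.range n, f (2 * j + 1) := by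
  induction n with
  | zero => simp
  | succ n ih =>
    rw [show 2 * (n + 1) = 2 * n + 1 + 1 by ring]
    simp only [Finset.sum_range_succ, ih]
    ring

lemma sum_oddWeight_three_mul_add_two (c : ℝ) (k : ℕ) :
    ∑ j ∈ Finset.range (2 ^ k), oddWeight c k (3 * (j : ℤ) + 2) =
      ∑ j ∈ Finset.range (2 ^ k), oddWeight c k j := by
  have maps : Set.MapsTo (fun j : ℕ => (3 * j + 2) % 2 ^ k)
      (Finset.range (2 ^ k)) (Finset.range (2 ^ k)) := by
    intro j _
    simpa using Nat.mod_lt _ (by positivity)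
  have inj : Set.InjOn (fun j : ℕ => (3 * j + 2) % 2 ^ k) (Finset.range (2 ^ k)) := by
    intro a ha b hb hab
    simp only [Finset.coe_range, Set.mem_Iio] at ha hb
    have hab : 3 * a + 2 ≡ 3 * b + 2 [MOD 2 ^ k] := hab
    have hcop : Nat.gcd (2 ^ k) 3 = 1 := Nat.Coprime.pow_left k (by norm_num)
    exact ((hab.add_right_cancel' 2).cancel_left_of_coprime hcop).eq_of_lt_of_lt ha hb
  refine Finset.sum_nbij (fun j : ℕ => (3 * j + 2) % 2 ^ k) maps inj
    (Finset.surjOn_of_injOn_of_card_le _ maps inj le_rfl) fun j _ => ?_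
  push_cast
  rw [oddWeight_emod]

lemma sum_oddWeight (c : ℝ) (k : ℕ) :
    ∑ j ∈ Finset.range (2 ^ k), oddWeight c k j = (1 + c) ^ k := by
  induction k with
  | zero => simp [oddWeight]
  | succ k ih =>
    rw [pow_succ', sum_range_two_mul]
    push_cast
    simp only [oddWeight_two_mul, oddWeight_two_mul_add_one]
    rw [← Finset.mul_sum, sum_oddWeight_three_mul_add_two, ih]
    ring

lemma sum_oddWeight_mul (c : ℝ) (k q : ℕ) :
    ∑ j ∈ Finset.range (2 ^ k * q), oddWeight c k j = q * (1 + c) ^ k := by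
  induction q with
  | zero => simp
  | succ q ih =>
    rw [mul_add, mul_one, Finset.sum_range_add, ih]
    have h : ∀ j : ℕ, oddWeight c k ((2 ^ k * q + j : ℕ) : ℤ) = oddWeight c k j := fun j => by
      rw [← oddWeight_add_two_pow_mul c k j q]
      push_cast
      rw [add_comm]
    simp only [h, sum_oddWeight]
    push_cast
    ring

lemma sum_oddWeight_le {c : ℝ} (hc : 0 ≤ c) (k N : ℕ) :
    ∑ j ∈ Finset.Icc 1 N, oddWeight c k j ≤ (N / 2 ^ k + 1) * (1 + c) ^ k := by
  have hsub : Finset.Icc 1 N ⊆ Finset.range (2 ^ k * (N / 2 ^ k + 1)) := by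
    intro j hj
    have := Nat.lt_mul_div_succ N (show 0 < 2 ^ k by positivity)
    simp only [Finset.mem_Icc, Finset.mem_range] at hj ⊢
    omega
  calc ∑ j ∈ Finset.Icc 1 N, oddWeight c k j
      ≤ ∑ j ∈ Finset.range (2 ^ k * (N / 2 ^ k + 1)), oddWeight c k j :=
        Finset.sum_le_sum_of_subset_of_nonneg hsub fun _ _ _ => oddWeight_nonneg hc _ _
    _ = ((N / 2 ^ k + 1 : ℕ) : ℝ) * (1 + c) ^ k := sum_oddWeight_mul _ _ _
    _ ≤ _ := by
      gcongr
      have : ((N / 2 ^ k : ℕ) : ℝ) ≤ (N : ℝ) / ((2 ^ k : ℕ) : ℝ) := Nat.cast_div_le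
      push_cast at this ⊢
      linarith

lemma exists_collatzT_iterate_le (k : ℕ) :
    ∃ B : ℝ, ∀ n : ℤ, ((collatzT^[k] n : ℤ) : ℝ) ≤ oddWeight √3 k n ^ 2 / 2 ^ k * n + B := by
  induction k with
  | zero => exact ⟨0, fun n => by simp [oddWeight]⟩
  | succ k ih =>
    obtain ⟨B, hB⟩ := ih
    have h3 : √3 ^ 2 = (3 : ℝ) := Real.sq_sqrt (by norm_num)
    refine ⟨B + (√3 ^ k) ^ 2 / 2 ^ k, fun n => ?_⟩
    rw [Function.iterate_succ_apply]
    obtain ⟨j, rfl | rfl⟩ := Int.even_or_odd' n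
    · rw [oddWeight_two_mul, collatzT_two_mul]
      have h : (0 : ℝ) ≤ (√3 ^ k) ^ 2 / 2 ^ k := by positivity
      refine (hB j).trans ?_
      have : oddWeight √3 k j ^ 2 / 2 ^ (k + 1) * ((2 * j : ℤ) : ℝ)
          = oddWeight √3 k j ^ 2 / 2 ^ k * j := by
        push_cast; field_simp; ring
      linarith
    · rw [oddWeight_two_mul_add_one, collatzT_two_mul_add_one]
      refine (hB _).trans ?_
      set w := oddWeight √3 k (3 * j + 2)
      have hw : w ^ 2 / 2 ^ k ≤ (√3 ^ k) ^ 2 / 2 ^ k := by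
        gcongr
        · exact oddWeight_nonneg (by positivity) _ _
        · exact oddWeight_le_pow (Real.one_le_sqrt.2 (by norm_num)) _ _
      have hw' : 0 ≤ w ^ 2 / 2 ^ k := by positivity
      have : (√3 * w) ^ 2 / 2 ^ (k + 1) * ((2 * j + 1 : ℤ) : ℝ)
          = w ^ 2 / 2 ^ k * ((3 * j + 2 : ℤ) : ℝ) - w ^ 2 / 2 ^ k / 2 := by
        rw [mul_pow, h3]; push_cast; field_simp; ring
      linarith

lemma exists_card_le_collatzT_iterate_le {ρ : ℝ} (h0 : 0 < ρ) (k : ℕ) :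
    ∃ C : ℝ, ∀ N : ℕ,
      (((Finset.Icc 1 N).filter
          (fun m : ℕ => ρ * m ≤ ((collatzT^[k] (m : ℤ) : ℤ) : ℝ))).card : ℝ) ≤
        C + N * (((1 + √3) / (2 * √2)) ^ k / √(ρ / 2)) := by
  obtain ⟨B, hB⟩ := exists_collatzT_iterate_le k
  set δ := √(ρ / 2) with hδ
  have hδ0 : 0 < δ := Real.sqrt_pos.2 (by positivity)
  have hδ2 : δ ^ 2 = ρ / 2 := Real.sq_sqrt (by positivity)
  have h2 : (√2 ^ k) ^ 2 = (2 : ℝ) ^ k := by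
    rw [← pow_mul, mul_comm, pow_mul, Real.sq_sqrt (by norm_num)]
  set M := ⌊2 * B / ρ⌋₊
  refine ⟨M + (1 + √3) ^ k / (δ * √2 ^ k), fun N => ?_⟩
  have hsub : (Finset.Icc 1 N).filter
      (fun m : ℕ => ρ * m ≤ ((collatzT^[k] (m : ℤ) : ℤ) : ℝ)) ⊆ Finset.Icc 1 M ∪
      (Finset.Icc 1 N).filter (fun m : ℕ => 1 ≤ oddWeight √3 k m / (δ * √2 ^ k)) := by
    intro m hm
    simp only [Finset.mem_filter, Finset.mem_union, Finset.mem_Icc] at hm ⊢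
    obtain ⟨hmN, hm⟩ := hm
    by_contra! hcon
    have hM : 2 * B / ρ < m := (Nat.floor_lt' (by omega)).1 (hcon.1 hmN.1)
    have hw := hcon.2 hmN
    rw [div_lt_one (by positivity)] at hw
    have hw2 : oddWeight √3 k m ^ 2 / 2 ^ k < ρ / 2 := by
      rw [div_lt_iff₀ (by positivity), ← hδ2, ← h2, ← mul_pow]
      exact pow_lt_pow_left₀ hw (oddWeight_nonneg (by positivity) _ _) two_ne_zero
    have hm0 : (0 : ℝ) < m := by exact_mod_cast hmN.1
    rw [div_lt_iff₀ h0] at hM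
    have hmB := hm.trans (hB m)
    push_cast at hmB
    nlinarith [mul_lt_mul_of_pos_right hw2 hm0]
  have hmarkov : (((Finset.Icc 1 N).filter
      (fun m : ℕ => 1 ≤ oddWeight √3 k m / (δ * √2 ^ k))).card : ℝ) ≤
      (N / 2 ^ k + 1) * (1 + √3) ^ k / (δ * √2 ^ k) := by
    calc _ = ∑ m ∈ (Finset.Icc 1 N).filter
          (fun m : ℕ => 1 ≤ oddWeight √3 k m / (δ * √2 ^ k)), (1 : ℝ) := by simp
      _ ≤ ∑ m ∈ (Finset.Icc 1 N).filter
          (fun m : ℕ => 1 ≤ oddWeight √3 k m / (δ * √2 ^ k)),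
            oddWeight √3 k m / (δ * √2 ^ k) :=
        Finset.sum_le_sum fun m hm => (Finset.mem_filter.1 hm).2
      _ ≤ ∑ m ∈ Finset.Icc 1 N, oddWeight √3 k m / (δ * √2 ^ k) :=
        Finset.sum_le_sum_of_subset_of_nonneg (Finset.filter_subset _ _) fun _ _ _ =>
          div_nonneg (oddWeight_nonneg (by positivity) _ _) (by positivity)
      _ ≤ _ := by
        rw [← Finset.sum_div]
        gcongr
        exact sum_oddWeight_le (by positivity) k N
  have hcard := (Finset.card_le_card hsub).trans (Finset.card_union_le _ _)
  rw [Nat.card_Icc, Nat.add_sub_cancel] at hcard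
  have hcard' := (Nat.cast_le (α := ℝ)).2 hcard
  push_cast at hcard'
  have hsplit : (N / 2 ^ k + 1) * (1 + √3) ^ k / (δ * √2 ^ k) =
      (1 + √3) ^ k / (δ * √2 ^ k) + N * (((1 + √3) / (2 * √2)) ^ k / δ) := by
    rw [div_pow, mul_pow]
    field_simp
    ring
  linarith

lemma one_add_sqrt_three_div_lt_one : (1 + √3) / (2 * √2) < 1 := by
  have h3 : √3 ^ 2 = (3 : ℝ) := Real.sq_sqrt (by norm_num)
  rw [div_lt_one (by positivity)]
  refine lt_of_pow_lt_pow_left₀ 2 (by positivity) ?_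
  rw [mul_pow, Real.sq_sqrt (by norm_num)]
  nlinarith [sq_nonneg (√3 - 7 / 4), sq_nonneg (√3 - 2), Real.sqrt_nonneg 3]

/-- Venturini (1989): for any fixed `0 < ρ < 1`, the set of positive integers `m` for which
either some iterate `T^(i)(m) = 1` or some iterate `T^(i)(m) < ρ·m` has natural density one. -/
theorem venturini_density_one (ρ : ℝ) (h0 : 0 < ρ) (h1 : ρ < 1) :
    Tendsto (fun N : ℕ =>
      (((Finset.Icc 1 N).filter
          (fun m => (∃ i : ℕ, collatzT^[i] (m : ℤ) = 1) ∨
            ∃ i : ℕ, ((collatzT^[i] (m : ℤ) : ℤ) : ℝ) < ρ * m)).card : ℝ) / N)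
      atTop (nhds 1) := by
  rw [Metric.tendsto_atTop]
  intro ε hε
  have hr : Tendsto (fun k : ℕ => ((1 + √3) / (2 * √2)) ^ k / √(ρ / 2)) atTop (nhds 0) := by
    simpa using (tendsto_pow_atTop_nhds_zero_of_lt_one (by positivity)
      one_add_sqrt_three_div_lt_one).div_const √(ρ / 2)
  obtain ⟨k, hk⟩ := (hr.eventually (gt_mem_nhds (half_pos hε))).exists
  obtain ⟨C, hC⟩ := exists_card_le_collatzT_iterate_le h0 k
  obtain ⟨N₀, hN₀⟩ := ((tendsto_const_div_atTop_nhds_zero_nat C).eventually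
    (gt_mem_nhds (half_pos hε))).exists_forall_of_atTop
  refine ⟨max N₀ 1, fun N hN => ?_⟩
  have hCN := hN₀ N (le_of_max_le_left hN)
  have hNpos : (0 : ℝ) < N := by exact_mod_cast le_of_max_le_right hN
  set p : ℕ → Prop := fun m => (∃ i : ℕ, collatzT^[i] (m : ℤ) = 1) ∨
    ∃ i : ℕ, ((collatzT^[i] (m : ℤ) : ℤ) : ℝ) < ρ * m
  have hsum := Finset.card_filter_add_card_filter_not (s := Finset.Icc 1 N) p
  rw [Nat.card_Icc, Nat.add_sub_cancel] at hsum
  have hsum' : (((Finset.Icc 1 N).filter p).card : ℝ) +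
      ((Finset.Icc 1 N).filter (fun m => ¬ p m)).card = N := by exact_mod_cast hsum
  have hbad : (((Finset.Icc 1 N).filter (fun m => ¬ p m)).card : ℝ) ≤
      C + N * (((1 + √3) / (2 * √2)) ^ k / √(ρ / 2)) := by
    refine le_trans (Nat.cast_le.2 (Finset.card_le_card ?_)) (hC N)
    refine Finset.monotone_filter_right _ fun m _ hm => ?_
    by_contra! hlt
    exact hm (Or.inr ⟨k, hlt⟩)
  rw [div_lt_iff₀ hNpos] at hCN
  have hkN := mul_lt_mul_of_pos_left hk hNpos
  have hnn : (0 : ℝ) ≤ ((Finset.Icc 1 N).filter (fun m => ¬ p m)).card := Nat.cast_nonneg _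
  have himage : (Finset.Icc 1 N >>= fun a => pure (a : ℤ)) =
      (Finset.Icc 1 N).image (Nat.cast : ℕ → ℤ) := by
    rw [bind_pure_comp, Finset.fmap_def]
    congr!
  rw [himage, Finset.filter_image, Finset.card_image_of_injective _ Nat.cast_injective]
  simp only [Int.cast_natCast]
  rw [Real.dist_eq, abs_sub_lt_iff]
  constructor
  · rw [sub_lt_iff_lt_add, div_lt_iff₀ hNpos]
    nlinarith
  · rw [sub_lt_comm, lt_div_iff₀ hNpos]
    nlinarith
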